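/- The kernel of Ψ (the ideal of relations among the 2×2 minors of a generic m×n matrix) is generated, as an ideal of R, by its homogeneous elements of degrees 2 and 3; that is, ker Ψ equals the ideal of R generated by (ker Ψ)_2 ∪ (ker Ψ)_3. -/

import Mathlib

open MvPolynomial

/-- Index set for the 2×2 minors of a generic `m × n` matrix:
quadruples `((i,i'),(j,j'))` with `i < i'` and `j < j'`. -/
def MinorIdx (m n : ℕ) : Type :=
  {w : (Fin m × Fin m) × (Fin n × Fin n) // w.1.1 < w.1.2 ∧ w.2.1 < w.2.2}

/-- The 2×2 minor `Δ_{(i,i'),(j,j')} = x_{i,j} x_{i',j'} - x_{i,j'} x_{i',j}`. -/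
noncomputable def minorΔ {m n : ℕ} (w : MinorIdx m n) : MvPolynomial (Fin m × Fin n) ℂ :=
  X (w.1.1.1, w.1.2.1) * X (w.1.1.2, w.1.2.2) - X (w.1.1.1, w.1.2.2) * X (w.1.1.2, w.1.2.1)

/-- The ℂ-algebra map `Ψ : R → S` sending `y_w` to the corresponding 2×2 minor. -/
noncomputable def Psi (m n : ℕ) :
    MvPolynomial (MinorIdx m n) ℂ →ₐ[ℂ] MvPolynomial (Fin m × Fin n) ℂ :=
  aeval minorΔ

set_option linter.unusedSectionVars false

namespace MinRel
open Equiv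

section alg
variable {D : Type} [Fintype D] [DecidableEq D]

lemma z2_add_self (a : ZMod 2) : a + a = 0 := by revert a; decide

/-- Flip of the blocks where `x` is nonzero. -/
def fl (x : D → ZMod 2) : Perm (D × ZMod 2) where
  toFun p := (p.1, p.2 + x p.1)
  invFun p := (p.1, p.2 + x p.1)
  left_inv p := by simp [add_assoc, z2_add_self]
  right_inv p := by simp [add_assoc, z2_add_self]

/-- Layerwise permutation of blocks. -/
def bl (f : ZMod 2 → Perm D) : Perm (D × ZMod 2) where
  toFun p := (f p.2 p.1, p.2)
  invFun p := ((f p.2)⁻¹ p.1, p.2)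
  left_inv p := by simp
  right_inv p := by simp

@[simp] lemma fl_apply (x : D → ZMod 2) (p) : fl x p = (p.1, p.2 + x p.1) := rfl
@[simp] lemma bl_apply (f : ZMod 2 → Perm D) (p) : bl f p = (f p.2 p.1, p.2) := rfl

/-- acts on layer one only -/
def uu (p : Perm D) : Perm (D × ZMod 2) := bl (fun ε => if ε = 1 then p else 1)
/-- block permutation -/
def nn (p : Perm D) : Perm (D × ZMod 2) := bl (fun _ => p)

lemma fl_mul (x y : D → ZMod 2) : fl x * fl y = fl (x + y) := by
  ext p <;> simp; abel_nf

lemma bl_mul (f g : ZMod 2 → Perm D) : bl f * bl g = bl (f * g) := by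
  ext p <;> simp

lemma fl_zero : fl (0 : D → ZMod 2) = 1 := by ext p <;> simp

lemma uu_mul (p q : Perm D) : uu p * uu q = uu (p * q) := by
  unfold uu; rw [bl_mul]; congr 1; ext ε a; simp only [Pi.mul_apply]; split_ifs <;> simp

lemma nn_mul (p q : Perm D) : nn p * nn q = nn (p * q) := by
  unfold nn; rw [bl_mul]; rfl

lemma fl_comm_bl (x : D → ZMod 2) (f : ZMod 2 → Perm D) (h : ∀ a, x a ≠ 0 → ∀ ε, f ε a = a) :
    fl x * bl f = bl f * fl x := by
  ext1 ⟨a, ε⟩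
  simp only [Perm.mul_apply, fl_apply, bl_apply]
  by_cases hx : x a = 0
  · have : x (f ε a) = 0 := by
      by_contra h'
      have := h _ h' ε
      have := (f ε).injective this
      rw [this] at h'; exact h' hx
    simp [hx, this]
  · simp [h a hx]

lemma fl_comm_uu (x : D → ZMod 2) (p : Perm D) (h : ∀ a, x a ≠ 0 → p a = a) :
    fl x * uu p = uu p * fl x := by
  apply fl_comm_bl
  intro a ha ε
  split_ifs
  · exact h a ha
  · rfl

lemma fl_nn (x : D → ZMod 2) (p : Perm D) : fl x * nn p = nn p * fl (x ∘ p) := by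
  ext1 ⟨a, ε⟩; simp [nn]

/-- Conjugating by flips on a set containing the support moves to the other layer. -/
lemma fl_uu_fl (x : D → ZMod 2) (p : Perm D) (h : ∀ a, x a = 0 → p a = a) :
    fl x * uu p * fl x = nn p * uu p⁻¹ := by
  ext1 ⟨a, ε⟩
  have h2 : ∀ z : ZMod 2, z = 0 ∨ z = 1 := by decide
  have h1 : x a = 0 → x (p a) = 0 := fun h0 => by rw [h a h0, h0]
  have h1' : x a = 1 → x (p a) = 1 := fun h0 => by
    rcases h2 (x (p a)) with h3 | h3
    · have := p.injective (h _ h3); rw [this, h0] at h3; exact absurd h3 (by decide)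
    · exact h3
  have e2 : (1 : ZMod 2) + 1 = 0 := by decide
  rcases h2 (x a) with h0 | h0 <;> rcases h2 ε with rfl | rfl
  · simp [uu, nn, h0, h a h0]
  · have : p⁻¹ a = a := by rw [Perm.inv_eq_iff_eq, h a h0]
    simp [uu, nn, h0, h a h0]
  · simp [uu, nn, h0, h1' h0, e2]
  · simp [uu, nn, h0, e2]

variable {A : Type*} [Ring A] [Algebra ℂ A] (ρ : Perm (D × ZMod 2) →* A)

/-- sum over the flip group -/
noncomputable def ee : A := ∑ x : D → ZMod 2, ρ (fl x)

lemma ee_fl (x : D → ZMod 2) : ee ρ * ρ (fl x) = ee ρ := by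
  unfold ee
  rw [Finset.sum_mul]
  simp only [← map_mul, fl_mul]
  exact Fintype.sum_equiv (Equiv.addRight x) _ _ (fun y => rfl)

lemma fl_ee (x : D → ZMod 2) : ρ (fl x) * ee ρ = ee ρ := by
  unfold ee
  rw [Finset.mul_sum]
  simp only [← map_mul, fl_mul]
  exact Fintype.sum_equiv (Equiv.addLeft x) _ _ (fun y => rfl)

lemma ee_nn (p : Perm D) : ee ρ * ρ (nn p) = ρ (nn p) * ee ρ := by
  unfold ee
  rw [Finset.mul_sum, Finset.sum_mul]
  simp only [← map_mul, fl_nn]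
  exact Fintype.sum_equiv (p.arrowCongr (Equiv.refl _)).symm _ _ (fun y => rfl)

lemma ee_ee : ee ρ * ee ρ = (Fintype.card (D → ZMod 2) : ℂ) • ee ρ := by
  nth_rewrite 1 [ee]
  rw [Finset.sum_mul]
  simp only [fl_ee]
  rw [Finset.sum_const, Finset.card_univ, Nat.cast_smul_eq_nsmul]

/-- the sandwiched element -/
noncomputable def sw (σ : Perm (D × ZMod 2)) : A := ee ρ * ρ σ * ee ρ

lemma sw_fl_mul (x : D → ZMod 2) (σ) : sw ρ (fl x * σ) = sw ρ σ := by
  simp only [sw, map_mul]; rw [← mul_assoc, ee_fl]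
lemma sw_mul_fl (x : D → ZMod 2) (σ) : sw ρ (σ * fl x) = sw ρ σ := by
  simp only [sw, map_mul]; rw [mul_assoc, mul_assoc, fl_ee, mul_assoc]
lemma sw_nn_mul (p : Perm D) (σ) : sw ρ (nn p * σ) = ρ (nn p) * sw ρ σ := by
  simp only [sw, map_mul]; rw [← mul_assoc, ee_nn]; simp only [mul_assoc]
lemma sw_mul_nn (p : Perm D) (σ) : sw ρ (σ * nn p) = sw ρ σ * ρ (nn p) := by
  simp only [sw, map_mul]; simp only [mul_assoc]; rw [ee_nn]

lemma sw_mul_sw (σ τ) : sw ρ σ * sw ρ τ =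
    (Fintype.card (D → ZMod 2) : ℂ) • ∑ x : D → ZMod 2, sw ρ (σ * fl x * τ) := by
  have : sw ρ σ * sw ρ τ = ee ρ * ρ σ * (ee ρ * ee ρ) * ρ τ * ee ρ := by
    simp only [sw, mul_assoc]
  rw [this, ee_ee]
  simp only [mul_smul_comm, smul_mul_assoc]
  congr 1
  simp only [sw, map_mul]
  nth_rewrite 2 [ee]
  simp only [Finset.mul_sum, Finset.sum_mul, mul_assoc]

variable (G : Subalgebra ℂ A)

lemma mem_of_smul {c : ℂ} (hc : c ≠ 0) {a : A} (h : c • a ∈ G) : a ∈ G := by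
  have := G.smul_mem h c⁻¹
  rwa [smul_smul, inv_mul_cancel₀ hc, one_smul] at this

lemma card_ne : (Fintype.card (D → ZMod 2) : ℂ) ≠ 0 := by
  exact_mod_cast Fintype.card_ne_zero

/-- disjoint supports -/
lemma disj (r q : Perm D) (h : ∀ a, r a = a ∨ q a = a)
    (hr : sw ρ (uu r) ∈ G) (hq : sw ρ (uu q) ∈ G) : sw ρ (uu (r * q)) ∈ G := by
  have := G.mul_mem hr hq
  rw [sw_mul_sw] at this
  have h1 : ∀ x : D → ZMod 2, sw ρ (uu r * fl x * uu q) = sw ρ (uu (r * q)) := by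
    intro x
    set x1 : D → ZMod 2 := fun a => if r a = a then x a else 0 with hx1
    set x2 : D → ZMod 2 := fun a => if r a = a then 0 else x a with hx2
    have : fl x = fl x1 * fl x2 := by
      rw [fl_mul]; congr 1; ext a; simp only [hx1, hx2, Pi.add_apply]; split_ifs <;> simp
    rw [this, ← mul_assoc, ← fl_comm_uu x1 r (by intro a ha; by_contra h'; simp [hx1, h'] at ha),
      mul_assoc, mul_assoc, sw_fl_mul, fl_comm_uu x2 q, ← mul_assoc, sw_mul_fl, uu_mul]
    intro a ha
    rcases h a with h' | h'
    · simp [hx2, h'] at ha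
    · exact h'
  simp only [h1, Finset.sum_const, Finset.card_univ] at this
  have := mem_of_smul G card_ne this
  rw [← Nat.cast_smul_eq_nsmul ℂ] at this
  exact mem_of_smul G card_ne this

/-- supports meeting in a single point -/
lemma onept (r q : Perm D) (b : D) (h : ∀ a, a ≠ b → r a = a ∨ q a = a)
    (hrb : r b ≠ b)
    (hr : sw ρ (uu r) ∈ G) (hq : sw ρ (uu q) ∈ G) :
    sw ρ (uu (r * q)) + ρ (nn r) * sw ρ (uu (r⁻¹ * q)) ∈ G := by
  have := G.mul_mem hr hq
  rw [sw_mul_sw] at this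
  have this := mem_of_smul G card_ne this
  have key : ∀ x : D → ZMod 2, sw ρ (uu r * fl x * uu q) =
      sw ρ (uu r * fl (Pi.single b (x b)) * uu q) := by
    intro x
    set x1 : D → ZMod 2 := fun a => if r a = a then x a else 0 with hx1
    set x2 : D → ZMod 2 := fun a => if r a = a ∨ a = b then 0 else x a with hx2
    have : fl x = fl x1 * fl (Pi.single b (x b)) * fl x2 := by
      rw [fl_mul, fl_mul]; congr 1; ext a; simp only [hx1, hx2, Pi.add_apply]
      by_cases hab : a = b
      · subst hab; simp [hrb]
      · by_cases hra : r a = a <;> simp [hab, hra]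
    rw [this]
    have e1 : uu r * (fl x1 * fl (Pi.single b (x b)) * fl x2) * uu q =
      (uu r * fl x1) * fl (Pi.single b (x b)) * (fl x2 * uu q) := by simp only [mul_assoc]
    rw [e1, ← fl_comm_uu x1 r (by intro a ha; by_contra h'; simp [hx1, h'] at ha),
      fl_comm_uu x2 q]
    · have e2 : fl x1 * uu r * fl (Pi.single b (x b)) * (uu q * fl x2) =
        fl x1 * (uu r * fl (Pi.single b (x b)) * uu q * fl x2) := by simp only [mul_assoc]
      rw [e2, sw_fl_mul, sw_mul_fl]
    intro a ha
    by_cases hab : a = b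
    · simp [hx2, hab] at ha
    rcases h a hab with h' | h'
    · simp [hx2, h'] at ha
    · exact h'
  have h0 : sw ρ (uu r * fl (Pi.single b 0) * uu q) = sw ρ (uu (r * q)) := by
    rw [Pi.single_zero, fl_zero, mul_one, uu_mul]
  have h1 : sw ρ (uu r * fl (Pi.single b 1) * uu q) = ρ (nn r) * sw ρ (uu (r⁻¹ * q)) := by
    set x : D → ZMod 2 := fun a => if r a = a then 0 else 1 with hx
    set x2 : D → ZMod 2 := fun a => if r a = a ∨ a = b then 0 else 1 with hx2
    have e0 : fl (Pi.single b 1) * fl x2 = fl x := by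
      rw [fl_mul]; congr 1; ext a; simp only [hx, hx2, Pi.add_apply]
      by_cases hab : a = b
      · subst hab; simp [hrb]
      · simp [hab]
    have e1 : fl x2 * uu q = uu q * fl x2 := by
      apply fl_comm_uu
      intro a ha
      by_cases hab : a = b
      · simp [hx2, hab] at ha
      rcases h a hab with h' | h'
      · simp [hx2, h'] at ha
      · exact h'
    rw [← sw_mul_fl ρ x2, mul_assoc, ← e1, ← sw_fl_mul ρ x]
    have e2 : fl x * (uu r * fl (Pi.single b 1) * (fl x2 * uu q)) =
      fl x * uu r * (fl (Pi.single b 1) * fl x2) * uu q := by simp only [mul_assoc]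
    rw [e2, e0, fl_uu_fl x r (by intro a ha; by_contra h'; simp [hx, h'] at ha),
      mul_assoc, sw_nn_mul, uu_mul]
  rw [Finset.sum_congr rfl (fun x _ => key x)] at this
  have h3 : (∑ x : D → ZMod 2, sw ρ (uu r * fl (Pi.single b (x b)) * uu q)) =
      ∑ x : D → ZMod 2, sw ρ (uu r * fl (Pi.single b (x b + 1)) * uu q) := by
    refine (Fintype.sum_equiv (Equiv.addRight (Pi.single b 1)) _ _ (fun y => ?_)).symm
    simp
  have h4 := G.add_mem this this
  nth_rewrite 2 [h3] at h4
  rw [← Finset.sum_add_distrib] at h4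
  have h5 : ∀ x : D → ZMod 2, sw ρ (uu r * fl (Pi.single b (x b)) * uu q) +
    sw ρ (uu r * fl (Pi.single b (x b + 1)) * uu q) =
    sw ρ (uu (r * q)) + ρ (nn r) * sw ρ (uu (r⁻¹ * q)) := by
    intro x
    have h2 : ∀ z : ZMod 2, z = 0 ∨ z = 1 := by decide
    have e2 : (1 : ZMod 2) + 1 = 0 := by decide
    rcases h2 (x b) with h' | h' <;> rw [h']
    · rw [zero_add, h0, h1]
    · rw [e2, h0, h1, add_comm]
  simp only [h5, Finset.sum_const, Finset.card_univ] at h4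
  rw [← Nat.cast_smul_eq_nsmul ℂ] at h4
  exact mem_of_smul G card_ne h4


lemma conj_uu (s p : Perm D) (hs : s * s = 1) : uu (s * p * s) = nn s * uu p * nn s := by
  unfold uu nn; rw [bl_mul, bl_mul]; congr 1; ext ε a; simp only [Pi.mul_apply]
  split_ifs
  · simp
  · simp [hs]

lemma sw_inv (p : Perm D) : sw ρ (uu p) = ρ (nn p) * sw ρ (uu p⁻¹) := by
  rw [← sw_nn_mul, ← fl_uu_fl (fun _ => 1) p (by intro a ha; exact absurd ha (by decide)),
    sw_mul_fl, sw_fl_mul]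

lemma relL (p : Perm D) (b c : D) (hcb : b ≠ c) (h : p c = b)
    (h2 : sw ρ (uu (swap b c)) ∈ G) (hq : sw ρ (uu (swap b c * p)) ∈ G) :
    sw ρ (uu p) + ρ (nn (swap b c)) * sw ρ (uu p) ∈ G := by
  have := onept ρ G (swap b c) (swap b c * p) b ?_ (by simp [hcb.symm]) h2 hq
  · rwa [swap_inv, ← mul_assoc, swap_mul_self, one_mul] at this
  · intro a ha
    by_cases hac : a = c
    · right; subst hac; simp [h]
    · left; exact swap_apply_of_ne_of_ne ha hac

lemma relR (p : Perm D) (b c : D) (hcb : b ≠ c) (h : p c = b) (hb : p b ≠ c)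
    (h2 : sw ρ (uu (swap b c)) ∈ G) (hq : sw ρ (uu (p * swap b c)) ∈ G) :
    sw ρ (uu p) + sw ρ (uu p) * ρ (nn (swap b c)) ∈ G := by
  have := onept ρ G (p * swap b c) (swap b c) c ?_ (by simpa using hb) hq h2
  · rw [mul_assoc, swap_mul_self, mul_one, mul_inv_rev, swap_inv,
      conj_uu _ _ (swap_mul_self b c), sw_mul_nn, sw_nn_mul, ← mul_assoc, ← mul_assoc, ← map_mul,
      nn_mul, mul_assoc p, swap_mul_self, mul_one, ← sw_inv] at this
    exact this
  · intro a ha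
    by_cases hac : a = b
    · left; subst hac; simp [h]
    · right; exact swap_apply_of_ne_of_ne hac ha

lemma swap3 (b c d : D) (hbc : b ≠ c) (hbd : b ≠ d) (hcd : c ≠ d) :
    swap b c * swap c d = swap c d * swap d b := by
  ext a; simp only [Perm.mul_apply, swap_apply_def]; grind

lemma swap3' (b c d : D) (hbc : b ≠ c) (hbd : b ≠ d) (hcd : c ≠ d) :
    swap b c = swap c d * swap d b * swap c d := by
  rw [← swap3 b c d hbc hbd hcd, mul_assoc, swap_mul_self, mul_one]

lemma bigcyc (hn : ∀ p : Perm D, ρ (nn p) ∈ G) (p : Perm D) (b c d : D)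
    (hbc : b ≠ c) (hbd : b ≠ d) (hcd : c ≠ d) (hc : p c = d) (hd : p d = b) (hb : p b ≠ c)
    (h2 : ∀ b c : D, b ≠ c → sw ρ (uu (swap b c)) ∈ G)
    (h3 : sw ρ (uu (swap b c * swap c d)) ∈ G)
    (hq : sw ρ (uu ((swap b c * swap c d)⁻¹ * p)) ∈ G)
    (hA : sw ρ (uu (swap d c * p)) ∈ G) (hB : sw ρ (uu (swap b d * p)) ∈ G)
    (hC : sw ρ (uu (p * swap d c)) ∈ G) : sw ρ (uu p) ∈ G := by
  have rA := relL ρ G p d c hcd.symm hc (h2 _ _ hcd.symm) hA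
  have rB := relL ρ G p b d hbd hd (h2 _ _ hbd) hB
  have rC := relR ρ G p d c hcd.symm hc (by rw [hd]; exact hbc) (h2 _ _ hcd.symm) hC
  have r0 := onept ρ G (swap b c * swap c d) ((swap b c * swap c d)⁻¹ * p) b ?_ ?_ h3 hq
  · have e1 : (swap b c * swap c d)⁻¹ * ((swap b c * swap c d)⁻¹ * p) =
        swap c d * p * swap c d := by
      rw [mul_assoc (swap c d) p, Equiv.mul_swap_eq_swap_mul p, hc, hd, ← mul_assoc, ← mul_assoc]
      congr 1
      ext a; simp only [mul_inv_rev, swap_inv, Perm.mul_apply, swap_apply_def]; grind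
    rw [mul_inv_cancel_left, e1, conj_uu _ _ (swap_mul_self c d), sw_mul_nn, sw_nn_mul,
      ← mul_assoc, ← mul_assoc, ← map_mul, nn_mul, mul_assoc (swap b c), swap_mul_self, mul_one] at r0
    rw [swap_comm d c] at rA rC
    rw [swap_comm b d] at rB
    generalize sw ρ (uu p) = C at *
    have s1 := G.mul_mem (hn (swap b c)) rC
    have s2 := G.mul_mem (hn (swap c d * swap d b)) rA
    have s3 := G.mul_mem (hn (swap c d)) rB
    have t : ρ (nn (swap b c)) * C =
      ρ (nn (swap c d * swap d b)) * (ρ (nn (swap c d)) * C) := by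
      rw [← mul_assoc, ← map_mul, nn_mul, ← swap3' b c d hbc hbd hcd]
    have t2 : ρ (nn (swap c d * swap d b)) = ρ (nn (swap c d)) * ρ (nn (swap d b)) := by
      rw [← map_mul, nn_mul]
    have fin : (2 : ℂ) • C ∈ G := by
      have := G.add_mem (G.sub_mem (G.add_mem (G.sub_mem r0 s1) s2) s3) rA
      convert this using 1
      rw [mul_add, mul_add, mul_add, ← t, t2, two_smul]
      simp only [mul_assoc]
      abel
    exact mem_of_smul G two_ne_zero fin
  · intro a ha
    by_cases hac : a = c
    · right; subst hac; simp [hc, swap_apply_def]; grind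
    by_cases had : a = d
    · right; subst had; simp [hd]
    left
    rw [Perm.mul_apply, swap_apply_of_ne_of_ne hac had, swap_apply_of_ne_of_ne ha hac]
  · rw [Perm.mul_apply, swap_apply_of_ne_of_ne hbc hbd, swap_apply_left]; exact hbc.symm

lemma supp_lt (p q : Perm D) (c : D) (hp : p c ≠ c) (hq : q c = c)
    (h : ∀ a, p a = a → q a = a) : q.support.card < p.support.card := by
  apply Finset.card_lt_card
  rw [Finset.ssubset_iff_of_subset]
  · exact ⟨c, by simpa using hp, by simpa using hq⟩
  · intro a; simp only [Perm.mem_support]; exact fun h1 h2 => h1 (h a h2)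

theorem all_uu (hn : ∀ p : Perm D, ρ (nn p) ∈ G) (he : ee ρ ∈ G)
    (h2 : ∀ b c : D, b ≠ c → sw ρ (uu (swap b c)) ∈ G)
    (h3 : ∀ b c d : D, b ≠ c → b ≠ d → c ≠ d → sw ρ (uu (swap b c * swap c d)) ∈ G) :
    ∀ (k : ℕ) (p : Perm D), p.support.card = k → sw ρ (uu p) ∈ G := by
  intro k
  induction k using Nat.strong_induction_on with
  | _ k ih =>
  intro p hk
  subst hk
  replace ih : ∀ q : Perm D, q.support.card < p.support.card → sw ρ (uu q) ∈ G :=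
    fun q hq => ih _ hq q rfl
  by_cases hp1 : p = 1
  · subst hp1
    have : uu (1 : Perm D) = 1 := by ext a <;> simp [uu]
    rw [this, sw, map_one, mul_one]
    exact G.mul_mem he he
  obtain ⟨c, hc⟩ : ∃ c, p c ≠ c := by
    by_contra! h; exact hp1 (Equiv.ext h)
  obtain ⟨d, hd⟩ : ∃ d, d = p c := ⟨_, rfl⟩
  obtain ⟨b, hb⟩ : ∃ b, b = p d := ⟨_, rfl⟩
  have hinj := p.injective
  have hcd : c ≠ d := by rw [hd]; exact hc.symm
  have hbd : b ≠ d := by rw [hb]; intro h; rw [hd] at h; exact hc (hinj h)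
  by_cases hbc : b = c
  · subst hbc
    have : p = swap b d * (swap b d * p) := by rw [← mul_assoc, swap_mul_self, one_mul]
    rw [this]
    refine disj ρ G _ _ ?_ (h2 _ _ hbd) (ih _ ?_)
    · intro a; simp only [Perm.mul_apply, swap_apply_def]; grind
    · apply supp_lt p _ b hc
      · simp [← hd]
      · intro a; simp only [Perm.mul_apply, swap_apply_def]; grind
  by_cases hpb : p b = c
  · have : p = (swap b c * swap c d) * ((swap b c * swap c d)⁻¹ * p) := by
      rw [mul_inv_cancel_left]
    rw [this]
    refine disj ρ G _ _ ?_ (h3 _ _ _ hbc hbd hcd) (ih _ ?_)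
    · intro a; simp only [mul_inv_rev, swap_inv, Perm.mul_apply, swap_apply_def]; grind
    · apply supp_lt p _ c hc
      · simp [← hd, swap_apply_def]; grind
      · intro a; simp only [mul_inv_rev, swap_inv, Perm.mul_apply, swap_apply_def]; grind
  refine bigcyc ρ G hn p b c d hbc hbd hcd hd.symm hb.symm hpb h2 (h3 _ _ _ hbc hbd hcd)
    (ih _ ?_) (ih _ ?_) (ih _ ?_) (ih _ ?_)
  · apply supp_lt p _ c hc
    · simp [← hd, swap_apply_def]; grind
    · intro a; simp only [mul_inv_rev, swap_inv, Perm.mul_apply, swap_apply_def]; grind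
  · apply supp_lt p _ c hc
    · simp [← hd]
    · intro a; simp only [Perm.mul_apply, swap_apply_def]; grind
  · apply supp_lt p _ d (by rw [← hb]; exact hbd)
    · simp [← hb]
    · intro a; simp only [Perm.mul_apply, swap_apply_def]; grind
  · apply supp_lt p _ d (by rw [← hb]; exact hbd)
    · simp [← hd]
    · intro a; simp only [Perm.mul_apply, swap_apply_def]; grind

lemma z2_cases (z : ZMod 2) : z = 0 ∨ z = 1 := by revert z; decide

/-- normal form -/
theorem all_sw (hn : ∀ p : Perm D, ρ (nn p) ∈ G)
    (h : ∀ p : Perm D, sw ρ (uu p) ∈ G) (σ : Perm (D × ZMod 2)) : sw ρ σ ∈ G := by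
  obtain ⟨f, hf, hft⟩ := (Finset.all_card_le_biUnion_card_iff_exists_injective
    (fun b : D => Finset.univ.image (fun ε : ZMod 2 => (σ (b, ε)).1))).1 (by
      intro s
      have h1 : (s ×ˢ (Finset.univ : Finset (ZMod 2))).card ≤
        ((s.biUnion (fun b : D => Finset.univ.image (fun ε : ZMod 2 => (σ (b, ε)).1)))
          ×ˢ (Finset.univ : Finset (ZMod 2))).card := by
        apply Finset.card_le_card_of_injOn σ
        · rintro ⟨b, ε⟩ hb
          simp only [Finset.coe_product, Set.mem_prod, Finset.mem_coe] at hb ⊢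
          refine ⟨?_, Finset.mem_univ _⟩
          rw [Finset.mem_biUnion]
          exact ⟨b, hb.1, Finset.mem_image_of_mem _ (Finset.mem_univ ε)⟩
        · exact σ.injective.injOn
      simp only [Finset.card_product, Finset.card_univ, ZMod.card] at h1
      omega)
  have : ∀ b, ∃ ε, (σ (b, ε)).1 = f b := by
    intro b
    have := hft b
    simpa using this
  choose ε hε using this
  obtain ⟨pf, hpf⟩ : ∃ pf : Perm D, ∀ b, pf b = f b :=
    ⟨Equiv.ofBijective f (Finite.injective_iff_bijective.1 hf), fun b => rfl⟩
  obtain ⟨σ2, h2⟩ : ∃ σ2, σ2 = nn pf⁻¹ * (σ * fl ε) := ⟨_, rfl⟩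
  have hb2 : ∀ b, (σ2 (b, 0)).1 = b := by
    intro b
    rw [h2]; simp [nn, hε, ← hpf]
  obtain ⟨σ3, h3⟩ : ∃ σ3, σ3 = fl (fun b => (σ2 (b, 0)).2) * σ2 := ⟨_, rfl⟩
  have hb3 : ∀ b, σ3 (b, 0) = (b, 0) := by
    intro b
    rw [h3]; simp [hb2, z2_add_self]
  have hb4 : ∀ b, (σ3 (b, 1)).2 = 1 := by
    intro b
    rcases z2_cases (σ3 (b, 1)).2 with h | h
    · exfalso
      have h5 : σ3 (b, 1) = σ3 ((σ3 (b, 1)).1, 0) := by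
        rw [hb3]; exact Prod.ext rfl h
      have := σ3.injective h5
      have := congrArg Prod.snd this
      exact one_ne_zero (α := ZMod 2) this
    · exact h
  obtain ⟨g, hg⟩ : ∃ g : Perm D, ∀ b, g b = (σ3 (b, 1)).1 := by
    refine ⟨Equiv.ofBijective (fun b => (σ3 (b, 1)).1) (Finite.injective_iff_bijective.1 ?_),
      fun b => rfl⟩
    intro a b hab
    have : σ3 (a, 1) = σ3 (b, 1) := Prod.ext hab (by rw [hb4, hb4])
    exact congrArg Prod.fst (σ3.injective this)
  have h4 : σ3 = uu g := by
    ext1 ⟨a, z⟩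
    rcases z2_cases z with rfl | rfl
    · rw [hb3]; simp [uu]
    · have : σ3 (a, 1) = (g a, 1) := Prod.ext (hg a).symm (hb4 a)
      rw [this]; simp [uu]
  have h5 := h g
  rw [← h4, h3, sw_fl_mul, h2, sw_nn_mul, sw_mul_fl] at h5
  have h6 := G.mul_mem (hn pf) h5
  have e : nn pf * nn pf⁻¹ = 1 := by
    rw [nn_mul, mul_inv_cancel]; ext a <;> simp [nn]
  rwa [← mul_assoc, ← map_mul, e, map_one, one_mul] at h6

end alg
end MinRel

namespace MinRel
open Equiv

section hecke
variable {D : Type} [Fintype D] [DecidableEq D] {I K Q : Type} [AddCommGroup Q] [Module ℂ Q]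

/-- sign as a complex number -/
noncomputable def sg {ι : Type} [Fintype ι] [DecidableEq ι] : Perm ι →* ℂ :=
  (Int.castRingHom ℂ).toMonoidHom.comp ((Units.coeHom ℤ).comp Perm.sign)

lemma sg_mul_self {ι : Type} [Fintype ι] [DecidableEq ι] (σ : Perm ι) : sg σ * sg σ = 1 := by
  rcases Int.units_eq_one_or (Perm.sign σ) with h | h <;> simp [sg, h]

lemma sg_inv {ι : Type} [Fintype ι] [DecidableEq ι] (σ : Perm ι) : sg σ⁻¹ = sg σ := by
  simp [sg]

lemma sg_ne {ι : Type} [Fintype ι] [DecidableEq ι] (σ : Perm ι) : sg σ ≠ 0 :=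
  left_ne_zero_of_mul_eq_one (sg_mul_self σ)

/-- functions of a row labelling and a column labelling -/
abbrev VV (D I K Q : Type) := (D × ZMod 2 → I) → (D × ZMod 2 → K) → Q

/-- row action -/
noncomputable def Lr : Perm (D × ZMod 2) →* Module.End ℂ (VV D I K Q) where
  toFun σ :=
    { toFun := fun f i j => sg σ • f (i ∘ σ) j
      map_add' := fun f g => by ext; simp
      map_smul' := fun c f => by ext; simp [smul_comm c] }
  map_one' := by ext; simp
  map_mul' σ τ := by ext f i j; simp [mul_smul, Function.comp_assoc]

/-- column action -/
noncomputable def Rr : Perm (D × ZMod 2) →* (Module.End ℂ (VV D I K Q))ᵐᵒᵖ where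
  toFun σ := MulOpposite.op
    { toFun := fun f i j => sg σ • f i (j ∘ (σ⁻¹ : Perm _))
      map_add' := fun f g => by ext; simp
      map_smul' := fun c f => by ext; simp [smul_comm c] }
  map_one' := by apply MulOpposite.unop_injective; ext; simp
  map_mul' σ τ := by
    apply MulOpposite.unop_injective; ext f i j
    simp [mul_smul, smul_comm (sg σ)]; rfl

lemma Lr_apply (σ : Perm (D × ZMod 2)) (f : VV D I K Q) (i j) :
    Lr σ f i j = sg σ • f (i ∘ σ) j := rfl
lemma Rr_apply (σ : Perm (D × ZMod 2)) (f : VV D I K Q) (i j) :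
    (Rr σ).unop f i j = sg σ • f i (j ∘ (σ⁻¹ : Perm _)) := rfl

abbrev AA (D : Type) := MonoidAlgebra ℂ (Perm (D × ZMod 2))
noncomputable abbrev ofp : Perm (D × ZMod 2) →* AA D := MonoidAlgebra.of ℂ _

noncomputable def LL : AA D →ₐ[ℂ] Module.End ℂ (VV D I K Q) := MonoidAlgebra.lift ℂ _ _ Lr
noncomputable def RR : AA D →ₐ[ℂ] (Module.End ℂ (VV D I K Q))ᵐᵒᵖ := MonoidAlgebra.lift ℂ _ _ Rr

lemma LL_of (σ : Perm (D × ZMod 2)) : (LL (ofp σ) : Module.End ℂ (VV D I K Q)) = Lr σ :=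
  MonoidAlgebra.lift_of _ _
lemma RR_of (σ : Perm (D × ZMod 2)) : (RR (ofp σ) : (Module.End ℂ (VV D I K Q))ᵐᵒᵖ) = Rr σ :=
  MonoidAlgebra.lift_of _ _

lemma LR_comm (a b : AA D) (f : VV D I K Q) :
    LL a ((RR b).unop f) = (RR b).unop (LL a f) := by
  induction a using MonoidAlgebra.induction_linear with
  | zero => simp
  | add a a' h h' => simp [h, h']
  | single σ c =>
    induction b using MonoidAlgebra.induction_linear with
    | zero => simp
    | add b b' h h' => simp [h, h']
    | single τ e =>
      simp only [LL, RR, MonoidAlgebra.lift_single, MulOpposite.unop_smul, LinearMap.smul_apply,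
        map_smul]
      rw [smul_comm c e]
      congr 2
      ext i j
      simp only [Lr_apply, Rr_apply]
      rw [smul_comm]

/-- the subalgebra of elements whose row and column actions agree on `B` -/
noncomputable def GG (B : VV D I K Q) : Subalgebra ℂ (AA D) where
  carrier := {a | LL a B = (RR a).unop B}
  mul_mem' := by
    intro a b ha hb
    simp only [Set.mem_ofPred_eq] at *
    rw [map_mul, map_mul, MulOpposite.unop_mul, Module.End.mul_apply, Module.End.mul_apply,
      hb, LR_comm, ha]
  add_mem' := by
    intro a b ha hb
    simp only [Set.mem_ofPred_eq] at *
    simp [ha, hb]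
  algebraMap_mem' := by
    intro c
    simp only [Set.mem_ofPred_eq, AlgHom.commutes]
    rfl

lemma mem_GG (B : VV D I K Q) (a : AA D) : a ∈ GG B ↔ LL a B = (RR a).unop B := Iff.rfl

/-- antisymmetry -/
structure Good (B : VV D I K Q) : Prop where
  row : ∀ x i j, sg (fl x) • B (i ∘ fl x) j = B i j
  col : ∀ x i j, sg (fl x) • B i (j ∘ fl x) = B i j
  blk : ∀ p i j, B (i ∘ nn p) (j ∘ nn p) = B i j

variable {B : VV D I K Q}

lemma fl_inv (x : D → ZMod 2) : (fl x)⁻¹ = fl x := by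
  rw [inv_eq_iff_mul_eq_one, fl_mul]
  have : x + x = 0 := by ext a; simp [z2_add_self]
  rw [this, fl_zero]

lemma Lfl (hB : Good B) (x : D → ZMod 2) : LL (ofp (fl x)) B = B := by
  rw [LL_of]; ext i j; exact hB.row x i j
lemma Rfl (hB : Good B) (x : D → ZMod 2) : (RR (ofp (fl x))).unop B = B := by
  rw [RR_of]; ext i j; rw [Rr_apply, fl_inv]; exact hB.col x i j

lemma nn_mem (hB : Good B) (p : Perm D) : ofp (nn p) ∈ GG B := by
  rw [mem_GG, LL_of, RR_of]
  ext i j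
  rw [Lr_apply, Rr_apply]
  congr 1
  rw [← hB.blk p i]
  congr 1
  ext a; simp

lemma ee_mem (hB : Good B) : ee (ofp (D := D)) ∈ GG B := by
  unfold ee
  refine sum_mem fun x _ => ?_
  rw [mem_GG, Lfl hB, Rfl hB]

variable {κ : Type} [Fintype κ]

/-- partial sum over flips -/
noncomputable def eT (xs : κ → D → ZMod 2) : AA D := ∑ k, ofp (fl (xs k))

lemma L_eT (hB : Good B) (xs : κ → D → ZMod 2) :
    LL (eT xs) B = (Fintype.card κ : ℂ) • B := by
  rw [eT, map_sum, LinearMap.sum_apply]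
  simp only [Lfl hB, Finset.sum_const, Finset.card_univ, Nat.cast_smul_eq_nsmul]
lemma R_eT (hB : Good B) (xs : κ → D → ZMod 2) :
    (RR (eT xs)).unop B = (Fintype.card κ : ℂ) • B := by
  rw [eT, map_sum, Finset.unop_sum, LinearMap.sum_apply]
  simp only [Rfl hB, Finset.sum_const, Finset.card_univ, Nat.cast_smul_eq_nsmul]

lemma eT_mem_iff (hB : Good B) [Nonempty κ] (xs : κ → D → ZMod 2) (σ : Perm (D × ZMod 2)) :
    eT xs * ofp σ * eT xs ∈ GG B ↔ ∀ i j,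
      ∑ k, sg (fl (xs k)) • B (i ∘ fl (xs k) ∘ σ) j =
      ∑ k, sg (fl (xs k)) • B i (j ∘ fl (xs k) ∘ (σ⁻¹ : Perm _)) := by
  have hc : (Fintype.card κ : ℂ) ≠ 0 := by exact_mod_cast Fintype.card_ne_zero
  have hl : LL (eT xs * ofp σ * eT xs) B = (Fintype.card κ : ℂ) • fun i j =>
      sg σ • ∑ k, sg (fl (xs k)) • B (i ∘ fl (xs k) ∘ σ) j := by
    rw [map_mul, Module.End.mul_apply, L_eT hB, map_smul, map_mul, Module.End.mul_apply, LL_of,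
      eT, map_sum, LinearMap.sum_apply]
    congr 1
    ext i j
    simp only [LL_of, Finset.sum_apply, Lr_apply, Finset.smul_sum]
    refine Finset.sum_congr rfl fun k _ => ?_
    rw [smul_comm]; rfl
  have hr : (RR (eT xs * ofp σ * eT xs)).unop B = (Fintype.card κ : ℂ) • fun i j =>
      sg σ • ∑ k, sg (fl (xs k)) • B i (j ∘ fl (xs k) ∘ (σ⁻¹ : Perm _)) := by
    rw [mul_assoc, map_mul, MulOpposite.unop_mul, Module.End.mul_apply, R_eT hB, map_smul, map_mul,
      MulOpposite.unop_mul, Module.End.mul_apply, RR_of,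
      eT, map_sum, Finset.unop_sum, LinearMap.sum_apply]
    congr 1
    ext i j
    simp only [RR_of, Finset.sum_apply, Rr_apply, Finset.smul_sum, fl_inv]
    refine Finset.sum_congr rfl fun k _ => ?_
    rw [smul_comm]; rfl
  rw [mem_GG, hl, hr, smul_right_inj hc]
  constructor
  · intro h i j
    have := congrFun (congrFun h i) j
    exact (smul_right_inj (sg_ne σ)).1 this
  · intro h
    ext i j
    rw [h]

lemma sw_mem_of_eT (hB : Good B) [Nonempty κ] (xs : κ → D → ZMod 2) (σ : Perm (D × ZMod 2))
    (h : eT xs * ofp σ * eT xs ∈ GG B) : sw ofp σ ∈ GG B := by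
  have hc : (Fintype.card κ : ℂ) ≠ 0 := by exact_mod_cast Fintype.card_ne_zero
  have h1 := mul_mem (mul_mem (ee_mem hB) h) (ee_mem hB)
  have e1 : ee ofp * eT xs = (Fintype.card κ : ℂ) • ee (ofp (D := D)) := by
    rw [eT, Finset.mul_sum]
    simp only [ee_fl, Finset.sum_const, Finset.card_univ, Nat.cast_smul_eq_nsmul]
  have e2 : eT xs * ee ofp = (Fintype.card κ : ℂ) • ee (ofp (D := D)) := by
    rw [eT, Finset.sum_mul]
    simp only [fl_ee, Finset.sum_const, Finset.card_univ, Nat.cast_smul_eq_nsmul]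
  have : ee ofp * (eT xs * ofp σ * eT xs) * ee ofp =
      (ee ofp * eT xs) * ofp σ * (eT xs * ee ofp) := by simp only [mul_assoc]
  rw [this, e1, e2, mul_smul_comm, smul_mul_assoc, smul_mul_assoc] at h1
  exact mem_of_smul _ hc (mem_of_smul _ hc h1)

lemma sw_full (hB : Good B) (σ : Perm (D × ZMod 2)) (h : sw ofp σ ∈ GG B) (i j) :
    ∑ x, sg (fl x) • B (i ∘ fl x ∘ σ) j =
      ∑ x, sg (fl x) • B i (j ∘ fl x ∘ (σ⁻¹ : Perm _)) :=
  (eT_mem_iff hB (fun x : D → ZMod 2 => x) σ).1 h i j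

/-- Key lemma: everything follows from the local relations on two or three blocks. -/
theorem hecke (hB : Good B)
    (h2 : ∀ b c : D, b ≠ c → ∀ i j,
      ∑ k : ZMod 2 × ZMod 2, sg (fl (Pi.single b k.1 + Pi.single c k.2)) •
        B (i ∘ fl (Pi.single b k.1 + Pi.single c k.2) ∘ uu (swap b c)) j =
      ∑ k : ZMod 2 × ZMod 2, sg (fl (Pi.single b k.1 + Pi.single c k.2)) •
        B i (j ∘ fl (Pi.single b k.1 + Pi.single c k.2) ∘ ((uu (swap b c))⁻¹ : Perm _)))
    (h3 : ∀ b c d : D, b ≠ c → b ≠ d → c ≠ d → ∀ i j,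
      ∑ k : ZMod 2 × ZMod 2 × ZMod 2,
        sg (fl (Pi.single b k.1 + Pi.single c k.2.1 + Pi.single d k.2.2)) •
        B (i ∘ fl (Pi.single b k.1 + Pi.single c k.2.1 + Pi.single d k.2.2) ∘
          uu (swap b c * swap c d)) j =
      ∑ k : ZMod 2 × ZMod 2 × ZMod 2,
        sg (fl (Pi.single b k.1 + Pi.single c k.2.1 + Pi.single d k.2.2)) •
        B i (j ∘ fl (Pi.single b k.1 + Pi.single c k.2.1 + Pi.single d k.2.2) ∘
          ((uu (swap b c * swap c d))⁻¹ : Perm _)))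
    (σ : Perm (D × ZMod 2)) (i j) :
    ∑ x, sg (fl x) • B (i ∘ fl x ∘ σ) j =
      ∑ x, sg (fl x) • B i (j ∘ fl x ∘ (σ⁻¹ : Perm _)) := by
  apply sw_full hB
  apply all_sw _ _ (nn_mem hB)
  intro p
  refine all_uu _ _ (nn_mem hB) (ee_mem hB) ?_ ?_ _ p rfl
  · intro b c hbc
    exact sw_mem_of_eT hB _ _ ((eT_mem_iff hB _ _).2 (h2 b c hbc))
  · intro b c d hbc hbd hcd
    exact sw_mem_of_eT hB _ _ ((eT_mem_iff hB _ _).2 (h3 b c d hbc hbd hcd))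

end hecke
end MinRel

namespace MinRel
open Equiv

section pos
variable {D : Type} [Fintype D] [DecidableEq D]

lemma posit (ψ : Perm (D × ZMod 2) → ℂ)
    (h : ∀ σ, ∑ π : Perm (D × ZMod 2), ∑ x : D → ZMod 2, ψ (σ * π * fl x * π⁻¹) = 0) :
    ∑ x : D → ZMod 2, ψ (fl x) = 0 := by
  set S : Perm (D × ZMod 2) → Perm (D × ZMod 2) → ℂ :=
    fun π σ => ∑ x : D → ZMod 2, ψ (σ * fl x * π⁻¹) with hS
  have hinv : ∀ π σ y, S π (σ * fl y) = S π σ := by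
    intro π σ y
    simp only [hS, mul_assoc σ, fl_mul]
    exact Fintype.sum_equiv (Equiv.addLeft y) _ _ (fun z => rfl)
  have h1 : ∑ π, ∑ σ, star (ψ (σ * π⁻¹)) * S π σ = 0 := by
    have : ∀ π, ∑ σ, star (ψ (σ * π⁻¹)) * S π σ = ∑ σ, star (ψ σ) * S π (σ * π) := by
      intro π
      exact Fintype.sum_equiv (Equiv.mulRight π⁻¹) _ _ (fun σ => by simp)
    simp only [this]
    rw [Finset.sum_comm]
    refine Finset.sum_eq_zero fun σ _ => ?_
    rw [← Finset.mul_sum, h, mul_zero]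
  have h2 : ∀ π, ∑ σ, star (S π σ) * S π σ =
      (Fintype.card (D → ZMod 2) : ℂ) * ∑ σ, star (ψ (σ * π⁻¹)) * S π σ := by
    intro π
    have : ∀ y : D → ZMod 2, ∑ σ, star (ψ (σ * fl y * π⁻¹)) * S π σ =
        ∑ σ, star (ψ (σ * π⁻¹)) * S π σ := by
      intro y
      refine Fintype.sum_equiv (Equiv.mulRight (fl y)) _ _ (fun σ => ?_)
      simp [hinv]
    calc ∑ σ, star (S π σ) * S π σ
        = ∑ σ, ∑ y : D → ZMod 2, star (ψ (σ * fl y * π⁻¹)) * S π σ := by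
          refine Finset.sum_congr rfl fun σ _ => ?_
          have e : star (S π σ) = ∑ y : D → ZMod 2, star (ψ (σ * fl y * π⁻¹)) := by
            simp only [hS, star_sum]
          rw [e, Finset.sum_mul]
      _ = _ := by
          rw [Finset.sum_comm]
          simp only [this, Finset.sum_const, Finset.card_univ, nsmul_eq_mul]
  have h3 : ∑ π, ∑ σ, star (S π σ) * S π σ = 0 := by
    simp only [h2]; rw [← Finset.mul_sum, h1, mul_zero]
  have h4 : ∑ π, ∑ σ, Complex.normSq (S π σ) = 0 := by
    have : ((∑ π, ∑ σ, Complex.normSq (S π σ) : ℝ) : ℂ) = 0 := by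
      rw [← h3]; push_cast
      refine Finset.sum_congr rfl fun π _ => Finset.sum_congr rfl fun σ _ => ?_
      rw [Complex.normSq_eq_conj_mul_self]; rfl
    exact_mod_cast this
  rw [Finset.sum_eq_zero_iff_of_nonneg
    (fun π _ => Finset.sum_nonneg fun σ _ => Complex.normSq_nonneg _)] at h4
  have h5 := h4 1 (Finset.mem_univ _)
  rw [Finset.sum_eq_zero_iff_of_nonneg (fun σ _ => Complex.normSq_nonneg _)] at h5
  have h6 := Complex.normSq_eq_zero.1 (h5 1 (Finset.mem_univ _))
  simpa [hS] using h6

lemma exists_perm {ι α : Type} [Fintype ι] (f g : ι → α)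
    (h : ∑ k, (Finsupp.single (f k) 1 : α →₀ ℕ) = ∑ k, Finsupp.single (g k) 1) :
    ∃ σ : Perm ι, f = g ∘ σ := by
  classical
  have hc : ∀ a, Fintype.card {k // f k = a} = Fintype.card {k // g k = a} := by
    intro a
    have := DFunLike.congr_fun h a
    simpa [Finsupp.finsetSum_apply, Finsupp.single_apply, Fintype.card_subtype] using this
  refine ⟨Equiv.ofFiberEquiv (fun a => Fintype.equivOfCardEq (hc a)), ?_⟩
  ext k
  exact (Equiv.ofFiberEquiv_map (fun a => Fintype.equivOfCardEq (hc a)) k).symm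

variable {I K Q : Type} [AddCommGroup Q] [Module ℂ Q]

/-- symmetrization -/
noncomputable def TT (B : VV D I K Q) : VV D I K Q := fun i j =>
  ∑ π : Perm (D × ZMod 2), B (i ∘ π) (j ∘ π)

lemma TT_perm (B : VV D I K Q) (i j) (σ : Perm (D × ZMod 2)) :
    TT B (i ∘ σ) (j ∘ σ) = TT B i j := by
  unfold TT
  exact Fintype.sum_equiv (Equiv.mulLeft σ) _ _ (fun π => rfl)

open Classical in
/-- the linear map from polynomials -/
noncomputable def th (B : VV D I K Q) : MvPolynomial (I × K) ℂ →ₗ[ℂ] Q :=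
  (basisMonomials (I × K) ℂ).constr ℂ (fun s =>
    if h : ∃ ij : (D × ZMod 2 → I) × (D × ZMod 2 → K),
      ∑ k, (Finsupp.single (ij.1 k, ij.2 k) 1 : I × K →₀ ℕ) = s
    then TT B h.choose.1 h.choose.2 else 0)

lemma prod_X_eq {ι τ : Type} [Fintype ι] (f : ι → τ) :
    ∏ k, (X (f k) : MvPolynomial τ ℂ) = monomial (∑ k, Finsupp.single (f k) 1) 1 := by
  rw [monomial_sum_one]; rfl

lemma th_prod (B : VV D I K Q) (i j) :
    th B (∏ k, X (i k, j k)) = TT B i j := by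
  have hb : ∀ s, monomial s (1 : ℂ) = basisMonomials (I × K) ℂ s := by simp [coe_basisMonomials]
  rw [prod_X_eq (fun k => (i k, j k)), hb, th, Module.Basis.constr_basis]
  have h : ∃ ij : (D × ZMod 2 → I) × (D × ZMod 2 → K),
      ∑ k, (Finsupp.single (ij.1 k, ij.2 k) 1 : I × K →₀ ℕ) =
      ∑ k, Finsupp.single (i k, j k) 1 := ⟨(i, j), rfl⟩
  rw [dif_pos h]
  obtain ⟨σ, hσ⟩ := exists_perm _ _ h.choose_spec
  have e1 : h.choose.1 = i ∘ σ := by ext k; exact congrArg Prod.fst (congrFun hσ k)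
  have e2 : h.choose.2 = j ∘ σ := by ext k; exact congrArg Prod.snd (congrFun hσ k)
  rw [e1, e2, TT_perm]

/-- injectivity on the span -/
theorem inj_span [Finite I] [Finite K] (B : VV D I K Q) (hB : Good B)
    (hk : ∀ (σ : Perm (D × ZMod 2)) i j, ∑ x, sg (fl x) • B (i ∘ fl x ∘ σ) j =
      ∑ x, sg (fl x) • B i (j ∘ fl x ∘ (σ⁻¹ : Perm _)))
    (P : Q →ₗ[ℂ] MvPolynomial (I × K) ℂ)
    (hP : ∀ i j, P (B i j) = ∑ x, sg (fl x) • ∏ k, X (i k, j (fl x k)))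
    (q : Q) (hq : q ∈ Submodule.span ℂ (Set.range (fun ij :
      (D × ZMod 2 → I) × (D × ZMod 2 → K) => B ij.1 ij.2))) (h0 : P q = 0) : q = 0 := by
  set M := Submodule.span ℂ (Set.range (fun ij :
      (D × ZMod 2 → I) × (D × ZMod 2 → K) => B ij.1 ij.2)) with hM
  have hBM : ∀ i j, B i j ∈ M := fun i j => Submodule.subset_span ⟨(i, j), rfl⟩
  have hTh : ∀ i j, th B (P (B i j)) =
      ∑ π : Perm (D × ZMod 2), ∑ x, sg (fl x) • B (i ∘ π ∘ fl x ∘ (π⁻¹ : Perm _)) j := by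
    intro i j
    rw [hP, map_sum]
    have : ∀ x : D → ZMod 2, th B (sg (fl x) • ∏ k, X (i k, j (fl x k))) =
        ∑ π : Perm (D × ZMod 2), sg (fl x) • B (i ∘ π) (j ∘ fl x ∘ π) := by
      intro x
      rw [map_smul, th_prod B i (fun k => j (fl x k)), TT, Finset.smul_sum]
      rfl
    simp only [this]
    rw [Finset.sum_comm]
    refine Finset.sum_congr rfl fun π _ => ?_
    have := hk π⁻¹ (i ∘ π) j
    rw [inv_inv] at this
    exact this.symm
  have hmaps : ∀ v ∈ M, th B (P v) ∈ M := by
    intro v hv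
    induction hv using Submodule.span_induction with
    | mem v hv =>
      obtain ⟨ij, rfl⟩ := hv
      simp only [hTh]
      exact sum_mem fun π _ => sum_mem fun x _ => M.smul_mem _ (hBM _ _)
    | zero => simp
    | add v w _ _ h1 h2 => rw [map_add, map_add]; exact M.add_mem h1 h2
    | smul c v _ h1 => rw [map_smul, map_smul]; exact M.smul_mem _ h1
  set Th : M →ₗ[ℂ] M := (th B ∘ₗ P).restrict hmaps with hThd
  have hfin : FiniteDimensional ℂ M := FiniteDimensional.span_of_finite ℂ (Set.finite_range _)
  have hsurj : M ≤ M.map (th B ∘ₗ P) := by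
    rw [hM, Submodule.span_le]
    rintro _ ⟨⟨i0, j0⟩, rfl⟩
    rw [← hM]
    by_contra hn
    obtain ⟨φ, hφ, hker⟩ := Submodule.exists_le_ker_of_notMem hn
    apply hφ
    have hz : ∀ i j, φ (th B (P (B i j))) = 0 := fun i j =>
      hker (Submodule.mem_map_of_mem (hBM i j))
    have := posit (fun σ => sg σ * φ (B (i0 ∘ σ) j0)) ?_
    · have h2 : ∀ x : D → ZMod 2, sg (fl x) * φ (B (i0 ∘ fl x) j0) = φ (B i0 j0) := by
        intro x
        rw [← smul_eq_mul, ← map_smul, hB.row]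
      simp only [h2, Finset.sum_const, Finset.card_univ, nsmul_eq_mul] at this
      exact (mul_eq_zero.1 this).resolve_left card_ne
    · intro σ
      have h1 := hz (i0 ∘ σ) j0
      rw [hTh, map_sum] at h1
      rw [← mul_zero (sg σ), ← h1, Finset.mul_sum]
      refine Finset.sum_congr rfl fun π _ => ?_
      rw [map_sum, Finset.mul_sum]
      refine Finset.sum_congr rfl fun x _ => ?_
      rw [map_smul, smul_eq_mul, ← mul_assoc]
      congr 1
      simp only [map_mul, sg_inv]
      linear_combination (sg σ * sg (fl x)) * sg_mul_self π
  have hsurj' : Function.Surjective Th := by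
    rintro ⟨v, hv⟩
    obtain ⟨w, hw, hwv⟩ := hsurj hv
    exact ⟨⟨w, hw⟩, Subtype.ext hwv⟩
  have hinj := LinearMap.injective_iff_surjective.2 hsurj'
  have : (⟨q, hq⟩ : M) = 0 := by
    apply hinj
    rw [map_zero]
    apply Subtype.ext
    simp [hThd, h0]
  exact congrArg Subtype.val this

end pos
end MinRel

namespace MinRel
open Equiv

section conc
variable {m n : ℕ}

/-- index constructor -/
def mkI (a b : Fin m) (c e : Fin n) (h : a < b ∧ c < e) : MinorIdx m n := ⟨((a, b), (c, e)), h⟩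

/-- antisymmetrized variable -/
noncomputable def Y (a b : Fin m) (c e : Fin n) : MvPolynomial (MinorIdx m n) ℂ :=
  if h : a < b ∧ c < e then X (mkI a b c e h)
  else if h : b < a ∧ c < e then - X (mkI b a c e h)
  else if h : a < b ∧ e < c then - X (mkI a b e c h)
  else if h : b < a ∧ e < c then X (mkI b a e c h)
  else 0

lemma Y_row (a b : Fin m) (c e : Fin n) : Y b a c e = - Y a b c e := by
  rcases lt_trichotomy a b with h | h | h <;> rcases lt_trichotomy c e with h' | h' | h' <;>
    simp [Y, h, h', h.not_gt, h'.not_gt]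

lemma Y_col (a b : Fin m) (c e : Fin n) : Y a b e c = - Y a b c e := by
  rcases lt_trichotomy a b with h | h | h <;> rcases lt_trichotomy c e with h' | h' | h' <;>
    simp [Y, h, h', h.not_gt, h'.not_gt]

lemma Psi_X (a b : Fin m) (c e : Fin n) (h : a < b ∧ c < e) :
    Psi m n (X (mkI a b c e h)) = X (a, c) * X (b, e) - X (a, e) * X (b, c) := aeval_X _ _

lemma Psi_Y (a b : Fin m) (c e : Fin n) :
    Psi m n (Y a b c e) = X (a, c) * X (b, e) - X (a, e) * X (b, c) := by
  rcases lt_trichotomy a b with h | h | h <;> rcases lt_trichotomy c e with h' | h' | h' <;>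
    simp [Y, h, h', h.not_gt, h'.not_gt, Psi_X] <;> ring

lemma Y_hom (a b : Fin m) (c e : Fin n) : (Y a b c e).IsHomogeneous 1 := by
  unfold Y
  split_ifs
  · exact isHomogeneous_X _ _
  · exact (isHomogeneous_X _ _).neg
  · exact (isHomogeneous_X _ _).neg
  · exact isHomogeneous_X _ _
  · exact isHomogeneous_zero _ _ _

lemma Y_idx (w : MinorIdx m n) : Y w.1.1.1 w.1.1.2 w.1.2.1 w.1.2.2 = X w := by
  unfold Y
  rw [dif_pos w.2]
  rfl

/-- sign of an element of `ZMod 2` -/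
def sz (z : ZMod 2) : ℂ := if z = 0 then 1 else -1

lemma sz_zero : sz 0 = 1 := by simp [sz]
lemma sz_one : sz 1 = -1 := by simp [sz]

lemma sum_z2 {M : Type*} [AddCommMonoid M] (f : ZMod 2 → M) : ∑ z, f z = f 0 + f 1 :=
  Fin.sum_univ_two f

variable (m n) in
/-- ideal generated in degrees two and three -/
noncomputable def JJ : Ideal (MvPolynomial (MinorIdx m n) ℂ) :=
  Ideal.span {f | f ∈ RingHom.ker (Psi m n) ∧ (f.IsHomogeneous 2 ∨ f.IsHomogeneous 3)}

lemma smul_hom {σ : Type} {f : MvPolynomial σ ℂ} {d : ℕ} (c : ℂ) (h : f.IsHomogeneous d) :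
    (c • f).IsHomogeneous d :=
  (homogeneousSubmodule σ ℂ d).smul_mem c h

lemma one_one : (1 + 1 : ZMod 2) = 0 := by decide

lemma F2_mem (p q : ZMod 2 → Fin m) (s t : ZMod 2 → Fin n) :
    ∑ k : ZMod 2 × ZMod 2, (sz k.1 * sz k.2) •
        (Y (p k.1) (q (1 + k.2)) (s 0) (s 1) * Y (q k.2) (p (1 + k.1)) (t 0) (t 1)) -
    ∑ k : ZMod 2 × ZMod 2, (sz k.1 * sz k.2) •
        (Y (p 0) (p 1) (s k.1) (t (1 + k.2)) * Y (q 0) (q 1) (t k.2) (s (1 + k.1))) ∈ JJ m n := by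
  refine Ideal.subset_span ⟨?_, Or.inl ?_⟩
  · rw [RingHom.mem_ker]
    simp only [map_sub, map_add, map_mul, Psi_Y, Fintype.sum_prod_type, sum_z2, sz_zero,
      sz_one, one_one, add_zero, smul_eq_C_mul, map_neg, map_one]
    ring
  · exact IsHomogeneous.sub
      (IsHomogeneous.sum _ _ _ fun k _ => smul_hom _ ((Y_hom _ _ _ _).mul (Y_hom _ _ _ _)))
      (IsHomogeneous.sum _ _ _ fun k _ => smul_hom _ ((Y_hom _ _ _ _).mul (Y_hom _ _ _ _)))

set_option maxHeartbeats 4000000 in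
lemma F3_mem (p q r : ZMod 2 → Fin m) (s t u : ZMod 2 → Fin n) :
    ∑ k : ZMod 2 × ZMod 2 × ZMod 2, (sz k.1 * sz k.2.1 * sz k.2.2) •
        (Y (p k.1) (q (1 + k.2.1)) (s 0) (s 1) * Y (q k.2.1) (r (1 + k.2.2)) (t 0) (t 1) *
          Y (r k.2.2) (p (1 + k.1)) (u 0) (u 1)) -
    ∑ k : ZMod 2 × ZMod 2 × ZMod 2, (sz k.1 * sz k.2.1 * sz k.2.2) •
        (Y (p 0) (p 1) (s k.1) (u (1 + k.2.2)) * Y (q 0) (q 1) (t k.2.1) (s (1 + k.1)) *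
          Y (r 0) (r 1) (u k.2.2) (t (1 + k.2.1))) ∈ JJ m n := by
  refine Ideal.subset_span ⟨?_, Or.inr ?_⟩
  · rw [RingHom.mem_ker]
    simp only [map_sub, map_add, map_mul, Psi_Y, Fintype.sum_prod_type, sum_z2, sz_zero,
      sz_one, one_one, add_zero, smul_eq_C_mul, map_neg, map_one]
    ring
  · exact IsHomogeneous.sub
      (IsHomogeneous.sum _ _ _ fun k _ => smul_hom _ (((Y_hom _ _ _ _).mul (Y_hom _ _ _ _)).mul
        (Y_hom _ _ _ _)))
      (IsHomogeneous.sum _ _ _ fun k _ => smul_hom _ (((Y_hom _ _ _ _).mul (Y_hom _ _ _ _)).mul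
        (Y_hom _ _ _ _)))

end conc
end MinRel

namespace MinRel
open Equiv

section conc2
variable {m n : ℕ} {D : Type} [Fintype D] [DecidableEq D]

lemma sg_fl (x : D → ZMod 2) : sg (fl x) = ∏ a, sz (x a) := by
  have h : fl x = prodCongrRight (fun a => Equiv.addRight (x a)) := by
    ext p <;> rfl
  have h2 : ∀ z : ZMod 2, ((Perm.sign (Equiv.addRight z) : ℤˣ) : ℤ) = if z = 0 then 1 else -1 := by
    decide
  have h3 : sg (fl x) = (((Perm.sign (fl x) : ℤˣ) : ℤ) : ℂ) := rfl
  rw [h3, h, Perm.sign_prodCongrRight]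
  push_cast
  refine Finset.prod_congr rfl fun a _ => ?_
  rw [h2, sz]
  split_ifs <;> simp

/-- product of antisymmetrized variables -/
noncomputable def BP (i : D × ZMod 2 → Fin m) (j : D × ZMod 2 → Fin n) :
    MvPolynomial (MinorIdx m n) ℂ :=
  ∏ a, Y (i (a, 0)) (i (a, 1)) (j (a, 0)) (j (a, 1))

lemma Y_flip_row (p : ZMod 2 → Fin m) (c e : Fin n) (z : ZMod 2) :
    Y (p (0 + z)) (p (1 + z)) c e = sz z • Y (p 0) (p 1) c e := by
  rcases z2_cases z with rfl | rfl
  · simp [sz_zero]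
  · rw [one_one, zero_add, Y_row, sz_one, neg_one_smul]

lemma Y_flip_col (p : ZMod 2 → Fin n) (c e : Fin m) (z : ZMod 2) :
    Y c e (p (0 + z)) (p (1 + z)) = sz z • Y c e (p 0) (p 1) := by
  rcases z2_cases z with rfl | rfl
  · simp [sz_zero]
  · rw [one_one, zero_add, Y_col, sz_one, neg_one_smul]

lemma BP_row (x : D → ZMod 2) (i : D × ZMod 2 → Fin m) (j : D × ZMod 2 → Fin n) :
    sg (fl x) • BP (i ∘ fl x) j = BP i j := by
  have : BP (i ∘ fl x) j = sg (fl x) • BP i j := by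
    rw [sg_fl, BP, BP, ← Finset.prod_smul]
    exact Finset.prod_congr rfl fun a _ => Y_flip_row (fun z => i (a, z)) _ _ _
  rw [this, smul_smul, sg_mul_self, one_smul]

lemma BP_col (x : D → ZMod 2) (i : D × ZMod 2 → Fin m) (j : D × ZMod 2 → Fin n) :
    sg (fl x) • BP i (j ∘ fl x) = BP i j := by
  have : BP i (j ∘ fl x) = sg (fl x) • BP i j := by
    rw [sg_fl, BP, BP, ← Finset.prod_smul]
    exact Finset.prod_congr rfl fun a _ => Y_flip_col (fun z => j (a, z)) _ _ _
  rw [this, smul_smul, sg_mul_self, one_smul]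

lemma BP_blk (p : Perm D) (i : D × ZMod 2 → Fin m) (j : D × ZMod 2 → Fin n) :
    BP (i ∘ nn p) (j ∘ nn p) = BP i j :=
  Equiv.prod_comp p (fun a => Y (i (a, 0)) (i (a, 1)) (j (a, 0)) (j (a, 1)))

lemma split2 {M : Type*} [CommMonoid M] (g : D → M) (b c : D) (h : b ≠ c) :
    ∏ a, g a = g b * g c * ∏ a ∈ (Finset.univ.erase b).erase c, g a := by
  rw [mul_assoc, Finset.mul_prod_erase _ _ (by simp [h.symm]), Finset.mul_prod_erase _ _ (by simp)]

lemma split3 {M : Type*} [CommMonoid M] (g : D → M) (b c d : D) (h : b ≠ c) (h' : b ≠ d)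
    (h'' : c ≠ d) :
    ∏ a, g a = g b * g c * g d * ∏ a ∈ ((Finset.univ.erase b).erase c).erase d, g a := by
  rw [mul_assoc (g b * g c), Finset.mul_prod_erase _ _ (by simp [h'.symm, h''.symm]),
    split2 g b c h]

lemma BP_uu (x : D → ZMod 2) (r : Perm D) (i : D × ZMod 2 → Fin m) (j : D × ZMod 2 → Fin n) :
    BP (i ∘ fl x ∘ uu r) j =
      ∏ a, Y (i (a, x a)) (i (r a, 1 + x (r a))) (j (a, 0)) (j (a, 1)) := by
  unfold BP
  refine Finset.prod_congr rfl fun a _ => ?_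
  simp [uu]

lemma BP_uu' (x : D → ZMod 2) (r : Perm D) (i : D × ZMod 2 → Fin m) (j : D × ZMod 2 → Fin n) :
    BP i (j ∘ fl x ∘ uu r) =
      ∏ a, Y (i (a, 0)) (i (a, 1)) (j (a, x a)) (j (r a, 1 + x (r a))) := by
  unfold BP
  refine Finset.prod_congr rfl fun a _ => ?_
  simp [uu]

lemma uu_inv (r : Perm D) : (uu r)⁻¹ = uu r⁻¹ := by
  rw [inv_eq_iff_mul_eq_one, uu_mul, mul_inv_cancel]
  ext p <;> simp [uu]

lemma sg_two (b c : D) (h : b ≠ c) (y z : ZMod 2) :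
    sg (fl (Pi.single b y + Pi.single c z)) = sz y * sz z := by
  rw [sg_fl, split2 _ b c h, Finset.prod_eq_one]
  · simp [h, h.symm]
  · intro a ha
    simp only [Finset.mem_erase] at ha
    simp [ha.1, ha.2.1, sz_zero]

lemma sg_three (b c d : D) (h : b ≠ c) (h' : b ≠ d) (h'' : c ≠ d) (y z w : ZMod 2) :
    sg (fl (Pi.single b y + Pi.single c z + Pi.single d w)) = sz y * sz z * sz w := by
  rw [sg_fl, split3 _ b c d h h' h'', Finset.prod_eq_one]
  · simp [h, h.symm, h', h'.symm, h'', h''.symm]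
  · intro a ha
    simp only [Finset.mem_erase] at ha
    simp [ha.1, ha.2.1, ha.2.2.1, sz_zero]

lemma loc2 (b c : D) (h : b ≠ c) (i : D × ZMod 2 → Fin m) (j : D × ZMod 2 → Fin n) :
    ∑ k : ZMod 2 × ZMod 2, sg (fl (Pi.single b k.1 + Pi.single c k.2)) •
        BP (i ∘ fl (Pi.single b k.1 + Pi.single c k.2) ∘ uu (swap b c)) j -
      ∑ k : ZMod 2 × ZMod 2, sg (fl (Pi.single b k.1 + Pi.single c k.2)) •
        BP i (j ∘ fl (Pi.single b k.1 + Pi.single c k.2) ∘ ((uu (swap b c))⁻¹ : Perm _))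
      ∈ JJ m n := by
  set P := ∏ a ∈ (Finset.univ.erase b).erase c, Y (i (a, 0)) (i (a, 1)) (j (a, 0)) (j (a, 1))
    with hP
  have key := Ideal.mul_mem_right P _ (F2_mem (fun z => i (b, z)) (fun z => i (c, z))
    (fun z => j (b, z)) (fun z => j (c, z)))
  rw [sub_mul, Finset.sum_mul, Finset.sum_mul] at key
  convert key using 3 with k _ k _
  · rw [sg_two b c h, smul_mul_assoc, BP_uu, split2 _ b c h]
    congr 2
    · simp [h, h.symm]
    · refine Finset.prod_congr rfl fun a ha => ?_
      simp only [Finset.mem_erase] at ha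
      simp [ha.1, ha.2.1, swap_apply_of_ne_of_ne]
  · rw [sg_two b c h, smul_mul_assoc, uu_inv, swap_inv, BP_uu', split2 _ b c h]
    congr 2
    · simp [h, h.symm]
    · refine Finset.prod_congr rfl fun a ha => ?_
      simp only [Finset.mem_erase] at ha
      simp [ha.1, ha.2.1, swap_apply_of_ne_of_ne]

set_option maxHeartbeats 1000000 in
lemma loc3 (b c d : D) (h : b ≠ c) (h' : b ≠ d) (h'' : c ≠ d)
    (i : D × ZMod 2 → Fin m) (j : D × ZMod 2 → Fin n) :
    ∑ k : ZMod 2 × ZMod 2 × ZMod 2,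
        sg (fl (Pi.single b k.1 + Pi.single c k.2.1 + Pi.single d k.2.2)) •
        BP (i ∘ fl (Pi.single b k.1 + Pi.single c k.2.1 + Pi.single d k.2.2) ∘
          uu (swap b c * swap c d)) j -
      ∑ k : ZMod 2 × ZMod 2 × ZMod 2,
        sg (fl (Pi.single b k.1 + Pi.single c k.2.1 + Pi.single d k.2.2)) •
        BP i (j ∘ fl (Pi.single b k.1 + Pi.single c k.2.1 + Pi.single d k.2.2) ∘
          ((uu (swap b c * swap c d))⁻¹ : Perm _)) ∈ JJ m n := by
  set P := ∏ a ∈ ((Finset.univ.erase b).erase c).erase d,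
    Y (i (a, 0)) (i (a, 1)) (j (a, 0)) (j (a, 1)) with hP
  have key := Ideal.mul_mem_right P _ (F3_mem (fun z => i (b, z)) (fun z => i (c, z))
    (fun z => i (d, z)) (fun z => j (b, z)) (fun z => j (c, z)) (fun z => j (d, z)))
  rw [sub_mul, Finset.sum_mul, Finset.sum_mul] at key
  have r1 : (swap b c * swap c d) b = c := by
    rw [Perm.mul_apply, swap_apply_of_ne_of_ne h h', swap_apply_left]
  have r2 : (swap b c * swap c d) c = d := by
    rw [Perm.mul_apply, swap_apply_left, swap_apply_of_ne_of_ne h'.symm h''.symm]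
  have r3 : (swap b c * swap c d) d = b := by
    rw [Perm.mul_apply, swap_apply_right, swap_apply_right]
  have r4 : ∀ a, a ≠ b → a ≠ c → a ≠ d → (swap b c * swap c d) a = a := by
    intro a h1 h2 h3
    rw [Perm.mul_apply, swap_apply_of_ne_of_ne h2 h3, swap_apply_of_ne_of_ne h1 h2]
  set r := swap b c * swap c d with hr
  have s1 : r⁻¹ c = b := by rw [Perm.inv_eq_iff_eq, r1]
  have s2 : r⁻¹ d = c := by rw [Perm.inv_eq_iff_eq, r2]
  have s3 : r⁻¹ b = d := by rw [Perm.inv_eq_iff_eq, r3]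
  have s4 : ∀ a, a ≠ b → a ≠ c → a ≠ d → r⁻¹ a = a := by
    intro a h1 h2 h3
    rw [Perm.inv_eq_iff_eq, r4 a h1 h2 h3]
  clear_value r
  convert key using 3 with k _ k _
  · rw [sg_three b c d h h' h'', smul_mul_assoc, BP_uu, split3 _ b c d h h' h'']
    refine congrArg _ (congrArg₂ (· * ·) ?_ ?_)
    · simp [h, h.symm, h', h'.symm, h'', h''.symm, r1, r2, r3]
    · refine Finset.prod_congr rfl fun a ha => ?_
      simp only [Finset.mem_erase] at ha
      simp [ha.1, ha.2.1, ha.2.2.1, r4]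
  · rw [sg_three b c d h h' h'', smul_mul_assoc, uu_inv, BP_uu', split3 _ b c d h h' h'']
    refine congrArg _ (congrArg₂ (· * ·) ?_ ?_)
    · simp only [s1, s2, s3]
      simp [h, h.symm, h', h'.symm, h'', h''.symm]
    · refine Finset.prod_congr rfl fun a ha => ?_
      simp only [Finset.mem_erase] at ha
      rw [s4 a ha.2.2.1 ha.2.1 ha.1]
      simp [ha.1, ha.2.1, ha.2.2.1]

lemma Psi_BP (i : D × ZMod 2 → Fin m) (j : D × ZMod 2 → Fin n) :
    Psi m n (BP i j) = ∑ x : D → ZMod 2, sg (fl x) • ∏ k, X (i k, j (fl x k)) := by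
  have h : ∀ a, Psi m n (Y (i (a, 0)) (i (a, 1)) (j (a, 0)) (j (a, 1))) =
      ∑ z : ZMod 2, sz z • ∏ e : ZMod 2, X (i (a, e), j (a, e + z)) := by
    intro a
    have hp : ∀ f : ZMod 2 → MvPolynomial (Fin m × Fin n) ℂ, ∏ e, f e = f 0 * f 1 :=
      fun f => Fin.prod_univ_two f
    rw [Psi_Y, sum_z2, hp, hp, sz_zero, sz_one, one_smul, neg_one_smul, one_one]
    simp only [add_zero, zero_add]
    ring
  rw [BP, map_prod]
  simp only [h]
  rw [Finset.prod_univ_sum, Fintype.piFinset_univ]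
  refine Finset.sum_congr rfl fun x _ => ?_
  rw [Finset.prod_smul, sg_fl, Fintype.prod_prod_type]
  rfl

end conc2
end MinRel

namespace MinRel
open Equiv

section fin
variable {m n : ℕ}

lemma JJ_le : JJ m n ≤ RingHom.ker (Psi m n) := by
  rw [JJ, Ideal.span_le]
  exact fun f hf => hf.1

lemma Psi_hom {d : ℕ} {f : MvPolynomial (MinorIdx m n) ℂ} (hf : f.IsHomogeneous d) :
    (Psi m n f).IsHomogeneous (2 * d) := by
  refine hf.aeval _ fun w => ?_
  exact ((isHomogeneous_X _ _).mul (isHomogeneous_X _ _)).sub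
    ((isHomogeneous_X _ _).mul (isHomogeneous_X _ _))

lemma comp_mem {f : MvPolynomial (MinorIdx m n) ℂ} (hf : Psi m n f = 0) (d : ℕ) :
    Psi m n (homogeneousComponent d f) = 0 := by
  have h1 : homogeneousComponent (2 * d) (Psi m n f) = 0 := by rw [hf, map_zero]
  rw [← sum_homogeneousComponent f, map_sum, map_sum] at h1
  have h2 : ∀ k, homogeneousComponent (2 * d) (Psi m n (homogeneousComponent k f)) =
      if k = d then Psi m n (homogeneousComponent d f) else 0 := by
    intro k
    rw [homogeneousComponent_of_mem (Psi_hom (homogeneousComponent_isHomogeneous k f))]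
    by_cases hk : k = d
    · subst hk; simp
    · rw [if_neg hk, if_neg (by omega)]
  simp only [h2, Finset.sum_ite_eq', Finset.mem_range] at h1
  by_cases hd : d < f.totalDegree + 1
  · rwa [if_pos hd] at h1
  · rw [homogeneousComponent_eq_zero _ _ (by omega), map_zero]

lemma exists_fin {τ : Type} (s : τ →₀ ℕ) :
    ∃ w : Fin s.degree → τ, ∑ k, (Finsupp.single (w k) 1 : τ →₀ ℕ) = s := by
  classical
  obtain ⟨l, hl⟩ := Quot.exists_rep (Finsupp.toMultiset s)
  have hl' : (l : Multiset τ) = Finsupp.toMultiset s := hl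
  have hlen : l.length = s.degree := by
    rw [← Multiset.coe_card, hl', Finsupp.card_toMultiset]; rfl
  have hs : ∑ k : Fin l.length, (Finsupp.single l[k.1] 1 : τ →₀ ℕ) = s := by
    apply (Multiset.toFinsupp (α := τ)).symm.injective
    change Finsupp.toMultiset _ = Finsupp.toMultiset _
    rw [map_sum, ← hl']
    simp only [Finsupp.toMultiset_single, one_smul]
    rw [Fin.sum_univ_fun_getElem l (fun t => ({t} : Multiset τ)), ← Multiset.sum_map_singleton (l : Multiset τ)]
    simp
  rw [← hlen]
  exact ⟨fun k => l[k.1], hs⟩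

lemma X_prod_eq_BP {d : ℕ} (w : Fin d → MinorIdx m n) :
    ∏ k, (X (w k) : MvPolynomial (MinorIdx m n) ℂ) =
      BP (fun p : Fin d × ZMod 2 => if p.2 = 0 then (w p.1).1.1.1 else (w p.1).1.1.2)
        (fun p : Fin d × ZMod 2 => if p.2 = 0 then (w p.1).1.2.1 else (w p.1).1.2.2) := by
  unfold BP
  refine Finset.prod_congr rfl fun a _ => ?_
  simp [Y_idx]

/-- the classes in the quotient -/
noncomputable def BQ (m n d : ℕ) :
    VV (Fin d) (Fin m) (Fin n) (MvPolynomial (MinorIdx m n) ℂ ⧸ JJ m n) :=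
  fun i j => Ideal.Quotient.mkₐ ℂ (JJ m n) (BP i j)

lemma mk_mem_span {d : ℕ} {f : MvPolynomial (MinorIdx m n) ℂ} (hf : f.IsHomogeneous d) :
    Ideal.Quotient.mkₐ ℂ (JJ m n) f ∈ Submodule.span ℂ (Set.range (fun ij :
      (Fin d × ZMod 2 → Fin m) × (Fin d × ZMod 2 → Fin n) => BQ m n d ij.1 ij.2)) := by
  rw [f.as_sum, map_sum]
  refine sum_mem fun s hs => ?_
  have hd : s.degree = d := by
    have := hf (mem_support_iff.1 hs)
    exact (DFunLike.congr_fun (Finsupp.degree_eq_weight_one (R := ℕ)) s).trans this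
  subst hd
  obtain ⟨w, hw⟩ := exists_fin s
  have e : monomial s (coeff s f) = coeff s f • ∏ k, (X (w k) : MvPolynomial (MinorIdx m n) ℂ) := by
    rw [prod_X_eq, hw, smul_monomial, smul_eq_mul, mul_one]
  rw [e, map_smul, X_prod_eq_BP]
  exact Submodule.smul_mem _ _ (Submodule.subset_span ⟨(_, _), rfl⟩)

lemma good_BQ (d : ℕ) : Good (BQ m n d) where
  row x i j := by
    unfold BQ; rw [← map_smul, BP_row]
  col x i j := by
    unfold BQ; rw [← map_smul, BP_col]
  blk p i j := by
    unfold BQ; rw [BP_blk]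

lemma mk_eq {x y : MvPolynomial (MinorIdx m n) ℂ} (h : x - y ∈ JJ m n) :
    Ideal.Quotient.mkₐ ℂ (JJ m n) x = Ideal.Quotient.mkₐ ℂ (JJ m n) y :=
  Ideal.Quotient.eq.2 h

lemma hecke_BQ (d : ℕ) (σ : Perm (Fin d × ZMod 2)) (i j) :
    ∑ x, sg (fl x) • BQ m n d (i ∘ fl x ∘ σ) j =
      ∑ x, sg (fl x) • BQ m n d i (j ∘ fl x ∘ (σ⁻¹ : Perm _)) := by
  refine hecke (good_BQ d) ?_ ?_ σ i j
  · intro b c h i j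
    unfold BQ
    simp only [← map_smul, ← map_sum]
    exact mk_eq (loc2 b c h i j)
  · intro b c d h h' h'' i j
    unfold BQ
    simp only [← map_smul, ← map_sum]
    exact mk_eq (loc3 b c d h h' h'' i j)

lemma hom_mem {d : ℕ} {f : MvPolynomial (MinorIdx m n) ℂ} (hf : f.IsHomogeneous d)
    (h0 : Psi m n f = 0) : f ∈ JJ m n := by
  set P : (MvPolynomial (MinorIdx m n) ℂ ⧸ JJ m n) →ₐ[ℂ] MvPolynomial (Fin m × Fin n) ℂ :=
    Ideal.Quotient.liftₐ (JJ m n) (Psi m n) (fun a ha => JJ_le ha) with hP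
  have hPm : ∀ g, P (Ideal.Quotient.mkₐ ℂ (JJ m n) g) = Psi m n g := fun g => rfl
  have := inj_span (BQ m n d) (good_BQ d) (hecke_BQ d) P.toLinearMap
    (fun i j => by
      change P (Ideal.Quotient.mkₐ ℂ (JJ m n) (BP i j)) = _
      rw [hPm, Psi_BP])
    _ (mk_mem_span hf) ((hPm f).trans h0)
  exact Ideal.Quotient.eq_zero_iff_mem.1 this

lemma ker_le : RingHom.ker (Psi m n) ≤ JJ m n := by
  intro f hf
  rw [← sum_homogeneousComponent f]
  exact sum_mem fun d _ => hom_mem (homogeneousComponent_isHomogeneous d f) (comp_mem hf d)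

end fin
end MinRel

/-- The ideal of relations among the 2×2 minors of a generic `m × n` matrix is
generated by its homogeneous elements of degrees 2 and 3. -/
theorem relations_minors_generated_in_degrees_two_and_three (m n : ℕ)
    (hm : 1 ≤ m) (hn : 1 ≤ n) :
    RingHom.ker (Psi m n) =
      Ideal.span {f | f ∈ RingHom.ker (Psi m n) ∧
        (f.IsHomogeneous 2 ∨ f.IsHomogeneous 3)} :=
  le_antisymm MinRel.ker_le MinRel.JJ_le
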